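/- Let k ≤ n be positive integers and let m = (m₁, m₂, …, m_n) be an n-tuple of positive integers with m_{n−k+1} = m_{n−k+2} = … = m_n = 1 and m_i ≥ 2 for each 1 ≤ i ≤ n − k. Then |E(m)| ≤ Σ_{r=2}^n Σ_{s=0}^r 2^{4(r−s)} binom(r,s) Σ_{t=s}^k (k!/(k−t)!) · binom(t−1, s−1) · Σ_{α ∈ 𝔙_{n−t; r−s; k−t}} ∏_{j=1}^{r−s} |m_{α^(j)}|!, where binom(t−1, s−1) is interpreted as 1 when s = t = 0 and as 0 when s = 0 < t. -/

import Mathlib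

open Nat Finset

attribute [local instance] Classical.propDecidable

/-- The series `ζ(k) = Σ_{j=1}^∞ j^{−k}` (convergent for `k ≥ 2`). -/
noncomputable def zetaSeries (k : ℤ) : ℝ :=
  ∑' j : ℕ, ((j : ℝ) + 1) ^ (-k)

/-- `𝔷(k) = (2 − 2^{2−k}) ζ(k)` for even integers `k ≥ 2`, `𝔷(0) = 1`, and `𝔷(k) = 0`
for all other integers `k` (in particular for odd or negative `k`). -/
noncomputable def zed (k : ℤ) : ℝ :=
  if k = 0 then 1
  else if 2 ≤ k ∧ Even k then (2 - (2 : ℝ) ^ (2 - k)) * zetaSeries k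
  else 0

/-- `P` is a (reduced) set partition of the finite set `S`: a collection of nonempty
disjoint subsets of `S` whose union is `S` (each element of `S` lies in exactly one
component). -/
def IsSetPartitionOn {ι : Type*} [DecidableEq ι] (S : Finset ι) (P : Finset (Finset ι)) :
    Prop :=
  (∀ s ∈ P, s ⊆ S ∧ s ≠ ∅) ∧ ∀ x ∈ S, ∃! s, s ∈ P ∧ x ∈ s

/-- The quantity `E(m)` of Eskin–Okounkov, for a weight function `v` on a finite ground
set `S`:
`E = Σ_{P partition of S, ℓ(P) ≥ 2} (−1)^{ℓ(P)−1} (ℓ(P)−2)!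
      Σ_{d : P → ℕ, Σ d = ℓ(P)−2} ∏_{s ∈ P} (1/d_s!) · |v_s|! · 𝔷(|v_s| − |s| − d_s + 1)`,
where `|v_s| = Σ_{x ∈ s} v(x)` and `|s|` is the cardinality of the component `s`. -/
noncomputable def Emap {ι : Type*} [Fintype ι] [DecidableEq ι]
    (S : Finset ι) (v : ι → ℕ) : ℝ :=
  ∑ P ∈ Finset.univ.filter
      (fun P : Finset (Finset ι) => IsSetPartitionOn S P ∧ 2 ≤ P.card),
    (-1 : ℝ) ^ (P.card - 1) * ((P.card - 2)! : ℝ) *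
      ∑ d ∈ Finset.finsuppAntidiag P (P.card - 2),
        ∏ s ∈ P,
          (1 / ((d s)! : ℝ) * ((∑ x ∈ s, v x)! : ℝ) *
            zed ((∑ x ∈ s, v x : ℤ) - s.card - d s + 1))

/-- `orderedV N r u` is the family `𝔙_{N; r; u}` of ordered (nonreduced) set partitions
`α = (α^(1), …, α^(r))` of `{1,…,N}` of length `r` such that no component `α^(i)` is a
subset of the last `u` elements `{N−u+1, …, N}` (equivalently, every component contains
an element among the first `N − u` elements). -/
def orderedV (N r u : ℕ) : Finset (Fin r → Finset (Fin N)) :=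
  Finset.univ.filter fun α =>
    (∀ i, α i ≠ ∅) ∧ (∀ i j, i ≠ j → Disjoint (α i) (α j)) ∧
      (∀ x : Fin N, ∃ i, x ∈ α i) ∧ ∀ i, ∃ x ∈ α i, (x : ℕ) < N - u

lemma zetaSeries_nonneg (k : ℤ) : 0 ≤ zetaSeries k :=
  tsum_nonneg fun _ => zpow_nonneg (by positivity) _

lemma zetaSeries_le_two {k : ℤ} (hk : 2 ≤ k) : zetaSeries k ≤ 2 := by
  have hsum : HasSum (fun j : ℕ => 1 / ((j + 1 : ℕ) : ℝ) ^ 2) (Real.pi ^ 2 / 6) := by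
    simpa using (hasSum_nat_add_iff' 1).2 hasSum_zeta_two
  have hle (j : ℕ) : ((j : ℝ) + 1) ^ (-k) ≤ 1 / ((j + 1 : ℕ) : ℝ) ^ 2 := by
    have hj : (1 : ℝ) ≤ (j : ℝ) + 1 := by linarith [j.cast_nonneg (α := ℝ)]
    calc ((j : ℝ) + 1) ^ (-k) ≤ ((j : ℝ) + 1) ^ (-2 : ℤ) :=
          zpow_le_zpow_right₀ hj (by omega)
      _ = 1 / ((j + 1 : ℕ) : ℝ) ^ 2 := by
          rw [zpow_neg, one_div]; push_cast; norm_cast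
  have h₁ : zetaSeries k ≤ Real.pi ^ 2 / 6 := by
    rw [← hsum.tsum_eq]
    exact (hsum.summable.of_nonneg_of_le (fun _ => zpow_nonneg (by positivity) _) hle).tsum_le_tsum
      hle hsum.summable
  nlinarith [Real.pi_lt_d2, Real.pi_pos]

lemma abs_zed_le (k : ℤ) : |zed k| ≤ 4 := by
  unfold zed
  split_ifs with h₀ h₁
  · norm_num
  · have hz := zetaSeries_le_two h₁.1
    have hz' := zetaSeries_nonneg k
    have hp : (2 : ℝ) ^ (2 - k) ≤ 1 := zpow_le_one_of_nonpos₀ (by norm_num) (by omega)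
    have hp' : (0 : ℝ) < (2 : ℝ) ^ (2 - k) := by positivity
    rw [abs_of_nonneg (mul_nonneg (by linarith) hz')]
    nlinarith
  · norm_num

lemma zed_one_sub_natCast {d : ℕ} (hd : d ≠ 1) : zed (1 - d) = 0 := by
  unfold zed
  rw [if_neg (by omega), if_neg (by omega)]

lemma sum_le_sum_of_mapsTo_injOn {ι κ : Type*} {s : Finset ι} {t : Finset κ} (i : ι → κ)
    {f : ι → ℝ} {g : κ → ℝ} (hi : Set.MapsTo i s t) (hinj : Set.InjOn i s)
    (hfg : ∀ a ∈ s, f a ≤ g (i a)) (hg : ∀ b ∈ t, 0 ≤ g b) :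
    ∑ a ∈ s, f a ≤ ∑ b ∈ t, g b :=
  calc ∑ a ∈ s, f a ≤ ∑ a ∈ s, g (i a) := sum_le_sum hfg
    _ = ∑ b ∈ s.image i, g b := (sum_image hinj).symm
    _ ≤ ∑ b ∈ t, g b := sum_le_sum_of_subset_of_nonneg
        (fun b hb => by obtain ⟨a, ha, rfl⟩ := mem_image.1 hb; exact hi ha) fun b hb _ => hg b hb

lemma sum_finsuppAntidiag_prod_le {ι : Type*} [DecidableEq ι] (s : Finset ι) (N : ℕ)
    (g : ι → ℕ → ℝ) (hg : ∀ a j, 0 ≤ g a j) :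
    ∑ d ∈ s.finsuppAntidiag N, ∏ a ∈ s, g a (d a) ≤
      ∏ a ∈ s, ∑ j ∈ range (N + 1), g a j := by
  rw [prod_sum]
  refine sum_le_sum_of_mapsTo_injOn (fun d a _ => d a) ?_ ?_ ?_ ?_
  · intro d hd
    rw [mem_coe, mem_finsuppAntidiag] at hd
    simp only [mem_coe, Finset.mem_pi, mem_range]
    intro a ha
    have hda := single_le_sum (f := d) (fun _ _ => Nat.zero_le _) ha
    rw [hd.1] at hda
    exact Nat.lt_succ_of_le hda
  · intro d hd d' hd' h
    rw [mem_coe, mem_finsuppAntidiag] at hd hd'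
    ext a
    by_cases ha : a ∈ s
    · exact congrFun (congrFun h a) ha
    · rw [Finsupp.notMem_support_iff.1 fun h => ha (hd.2 h),
        Finsupp.notMem_support_iff.1 fun h => ha (hd'.2 h)]
  · intro d _
    exact (prod_attach s fun a => g a (d a)).ge
  · intro p _
    exact prod_nonneg fun _ _ => hg _ _

lemma sum_prod_factorial_card_fiber_le {X Y : Type*} [Fintype X] [Fintype Y]
    (c : Y → ℕ) :
    ∑ f : X → Y with (fun y => Fintype.card {x // f x = y}) = c, ∏ y, (c y)! ≤
      (Fintype.card X)! := by
  by_cases h : ∃ f₀ : X → Y, (fun y => Fintype.card {x // f₀ x = y}) = c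
  · obtain ⟨f₀, rfl⟩ := h
    rw [← Fintype.card_perm, ← Finset.card_univ,
      card_eq_sum_card_fiberwise (f := fun σ : Equiv.Perm X => f₀ ∘ σ) (t := univ)
      (fun _ _ => mem_coe.2 (mem_univ _))]
    refine le_trans (sum_le_sum fun f hf => ?_) (sum_le_sum_of_subset (subset_univ _))
    rw [mem_filter] at hf
    have e (y : Y) : {x // f x = y} ≃ {x // f₀ x = y} :=
      Fintype.equivOfCardEq (congrFun hf.2 y)
    rw [← DomMulAct.stabilizer_card f₀, ← Finset.card_univ]
    refine card_le_card_of_injOn (fun τ => (Equiv.ofFiberEquiv e).trans τ.1) ?_ ?_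
    · intro τ _
      rw [mem_coe, mem_filter]
      refine ⟨mem_univ _, funext fun x => ?_⟩
      exact (congrFun τ.2 (Equiv.ofFiberEquiv e x)).trans (Equiv.ofFiberEquiv_map e x)
    · intro τ _ τ' _ h
      refine Subtype.ext (Equiv.ext fun x => ?_)
      obtain ⟨x, rfl⟩ := (Equiv.ofFiberEquiv e).surjective x
      exact congrArg (fun σ : Equiv.Perm X => σ x) h
  · push Not at h
    rw [sum_eq_zero fun f hf => absurd (mem_filter.1 hf).2 (h f)]
    exact Nat.zero_le _

lemma card_le_choose_of_pos_of_sum_eq {Y : Type*} [Fintype Y] {t : ℕ}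
    (C : Finset (Y → ℕ)) (hC : ∀ c ∈ C, (∀ y, 0 < c y) ∧ ∑ y, c y = t) :
    C.card ≤ if t < Fintype.card Y then 0 else
      if Fintype.card Y = 0 ∧ 0 < t then 0 else (t - 1).choose (Fintype.card Y - 1) := by
  rcases C.eq_empty_or_nonempty with rfl | ⟨c₀, hc₀⟩
  · simp
  have hle : ∀ c ∈ C, Fintype.card Y ≤ t := fun c hc => by
    rw [← (hC c hc).2, ← Finset.card_univ, card_eq_sum_ones]
    exact sum_le_sum fun y _ => (hC c hc).1 y
  have hcard := hle c₀ hc₀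
  rw [if_neg (by omega)]
  by_cases h₀ : Fintype.card Y = 0
  · have : IsEmpty Y := Fintype.card_eq_zero_iff.1 h₀
    have ht : t = 0 := by rw [← (hC c₀ hc₀).2]; simp
    rw [if_neg (by omega)]
    subst ht
    simpa [h₀] using C.card_le_one_of_subsingleton
  rw [if_neg (by omega)]
  calc C.card ≤ ((univ : Finset Y).finsuppAntidiag (t - Fintype.card Y)).card := by
        refine card_le_card_of_injOn (fun c => Finsupp.equivFunOnFinite.symm fun y => c y - 1)
          ?_ ?_
        · intro c hc
          have hc := hC c hc
          rw [mem_coe, mem_finsuppAntidiag]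
          refine ⟨?_, subset_univ _⟩
          have : ∑ y, (c y - 1) + ∑ _y : Y, 1 = ∑ y, c y := by
            rw [← sum_add_distrib]
            exact sum_congr rfl fun y _ => Nat.sub_add_cancel (hc.1 y)
          rw [hc.2, sum_const, Finset.card_univ, smul_eq_mul, mul_one] at this
          simp only [Finsupp.equivFunOnFinite_symm_apply_apply]
          omega
        · intro c hc c' hc' h
          funext y
          have := DFunLike.congr_fun h y
          have h₁ := (hC c hc).1 y
          have h₂ := (hC c' hc').1 y
          simp only [Finsupp.equivFunOnFinite_symm_apply_apply] at this
          omega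
    _ = (t - 1).choose (t - Fintype.card Y) := by
        rw [card_finsuppAntidiag_nat_eq_choose, Finset.card_univ]
        congr 1
        omega
    _ = (t - 1).choose (Fintype.card Y - 1) := by
        rw [← Nat.choose_symm (by omega)]
        congr 1
        omega

lemma sum_surjective_prod_factorial_le (X Y : Type*) [Fintype X] [Fintype Y] :
    ∑ f : X → Y with Function.Surjective f, ∏ y, (Fintype.card {x // f x = y})! ≤
      (Fintype.card X)! * if Fintype.card X < Fintype.card Y then 0 else
        if Fintype.card Y = 0 ∧ 0 < Fintype.card X then 0
        else (Fintype.card X - 1).choose (Fintype.card Y - 1) := by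
  set S : Finset (X → Y) := univ.filter Function.Surjective with hS
  set sizes : (X → Y) → Y → ℕ := fun f y => Fintype.card {x // f x = y} with hsizes
  rw [← sum_fiberwise_of_maps_to (fun f hf => mem_image_of_mem sizes hf)]
  calc _ ≤ ∑ c ∈ S.image sizes, (Fintype.card X)! := by
        refine sum_le_sum fun c _ => le_trans ?_ (sum_prod_factorial_card_fiber_le c)
        calc _ = ∑ f ∈ S with sizes f = c, ∏ y, (c y)! :=
              sum_congr rfl fun f hf => by rw [← (mem_filter.1 hf).2]
          _ ≤ _ := sum_le_sum_of_subset (filter_subset_filter _ (subset_univ _))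
    _ = (Fintype.card X)! * (S.image sizes).card := by
        rw [sum_const, smul_eq_mul, mul_comm]
    _ ≤ _ := by
        refine Nat.mul_le_mul_left _ (card_le_choose_of_pos_of_sum_eq _ fun c hc => ?_)
        obtain ⟨f, hf, rfl⟩ := mem_image.1 hc
        refine ⟨fun y => ?_, ?_⟩
        · obtain ⟨x, hx⟩ := (mem_filter.1 hf).2 y
          exact Fintype.card_pos_iff.2 ⟨⟨x, hx⟩⟩
        · rw [hsizes, ← Fintype.card_sigma]
          exact Fintype.card_congr (Equiv.sigmaFiberEquiv f)

/-- The fiber of `f` over `i`, as a finset. -/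
def fiberFinset {X : Type*} [Fintype X] {r : ℕ} (f : X → Fin r) (i : Fin r) : Finset X :=
  univ.filter fun x => f x = i

@[simp]
lemma mem_fiberFinset {X : Type*} [Fintype X] {r : ℕ} {f : X → Fin r} {i : Fin r} {x : X} :
    x ∈ fiberFinset f i ↔ f x = i := by
  simp [fiberFinset]

section Partitions

variable {X : Type*} [Fintype X] [DecidableEq X]

lemma IsSetPartitionOn.exists_blockMap {P : Finset (Finset X)} (hP : IsSetPartitionOn univ P) :
    ∃ b : X → P, Function.Surjective b ∧ ∀ x, ∀ s : P, x ∈ s.1 ↔ b x = s := by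
  choose b hb hb' using fun x => hP.2 x (mem_univ x)
  have key (x : X) (s : P) : x ∈ s.1 ↔ (⟨b x, (hb x).1⟩ : P) = s := by
    constructor
    · exact fun hx => Subtype.ext (hb' x s.1 ⟨s.2, hx⟩).symm
    · rintro rfl
      exact (hb x).2
  refine ⟨fun x => ⟨b x, (hb x).1⟩, fun s => ?_, key⟩
  obtain ⟨x, hx⟩ := Finset.nonempty_iff_ne_empty.2 (hP.1 s.1 s.2).2
  exact ⟨x, (key x s).1 hx⟩

lemma IsSetPartitionOn.card_le {P : Finset (Finset X)} (hP : IsSetPartitionOn univ P) :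
    P.card ≤ Fintype.card X := by
  obtain ⟨b, hb, -⟩ := hP.exists_blockMap
  simpa using Fintype.card_le_of_surjective b hb

lemma IsSetPartitionOn.factorial_le_card {P : Finset (Finset X)} {r : ℕ}
    (hP : IsSetPartitionOn univ P) (hr : P.card = r) :
    r ! ≤ (univ.filter fun f : X → Fin r =>
      Function.Surjective f ∧ univ.image (fiberFinset f) = P).card := by
  obtain ⟨b, hb, hb'⟩ := hP.exists_blockMap
  have e : P ≃ Fin r := P.equivFinOfCardEq hr
  have hcard : (univ : Finset (Equiv.Perm (Fin r))).card = r ! := by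
    rw [Finset.card_univ, Fintype.card_perm, Fintype.card_fin]
  rw [← hcard]
  refine card_le_card_of_injOn (fun σ x => σ (e (b x))) ?_ ?_
  · intro σ _
    rw [mem_coe, mem_filter]
    refine ⟨mem_univ _, (σ.surjective.comp e.surjective).comp hb, ?_⟩
    have hfib (s : P) : fiberFinset (fun x => σ (e (b x))) (σ (e s)) = s.1 := by
      ext x
      simp [hb']
    ext s
    rw [mem_image]
    constructor
    · rintro ⟨i, -, rfl⟩
      obtain ⟨s, rfl⟩ := (σ.surjective.comp e.surjective) i
      simp only [Function.comp_apply, hfib, s.2]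
    · exact fun hs => ⟨σ (e ⟨s, hs⟩), mem_univ _, hfib ⟨s, hs⟩⟩
  · intro σ _ τ _ h
    ext i
    obtain ⟨x, rfl⟩ := (e.surjective.comp hb) i
    exact congrArg Fin.val (congrFun h x)

lemma sum_setPartition_le (r : ℕ) (w : Finset X → ℝ) (hw : ∀ s, 0 ≤ w s) :
    ∑ P : Finset (Finset X) with IsSetPartitionOn univ P ∧ P.card = r,
        (r ! : ℝ) * ∏ s ∈ P, w s ≤
      ∑ f : X → Fin r with Function.Surjective f, ∏ i, w (fiberFinset f i) := by
  rw [← sum_fiberwise_of_maps_to (g := fun f => univ.image (fiberFinset f)) (t := univ)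
    (fun _ _ => mem_univ _)]
  refine le_trans (sum_le_sum fun P hP => ?_) (sum_le_sum_of_subset_of_nonneg (filter_subset _ _)
    fun P _ _ => sum_nonneg fun f _ => prod_nonneg fun i _ => hw _)
  obtain ⟨-, hP, hr⟩ := mem_filter.1 hP
  rw [filter_filter]
  calc (r ! : ℝ) * ∏ s ∈ P, w s ≤ _ * ∏ s ∈ P, w s :=
        mul_le_mul_of_nonneg_right (Nat.cast_le.2 (hP.factorial_le_card hr))
          (prod_nonneg fun s _ => hw s)
    _ = ∑ f : X → Fin r with Function.Surjective f ∧ univ.image (fiberFinset f) = P,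
          ∏ s ∈ P, w s := by rw [sum_const, nsmul_eq_mul]
    _ ≤ _ := le_of_eq <| sum_congr rfl fun f hf => by
        obtain ⟨-, hsurj, rfl⟩ := mem_filter.1 hf
        refine prod_image fun i _ j _ h => ?_
        obtain ⟨x, rfl⟩ := hsurj i
        exact mem_fiberFinset.1 (h ▸ mem_fiberFinset.2 rfl)

end Partitions

/-- The last `k` elements of `Fin n`. -/
def lastElts (n k : ℕ) : Finset (Fin n) :=
  univ.filter fun x => n - k ≤ (x : ℕ)

lemma mem_lastElts {n k : ℕ} {x : Fin n} : x ∈ lastElts n k ↔ n - k ≤ (x : ℕ) := by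
  simp [lastElts]

lemma card_lastElts {n k : ℕ} (hkn : k ≤ n) : (lastElts n k).card = k := by
  have h := card_filter_add_card_filter_not (s := (univ : Finset (Fin n)))
    (fun x => (x : ℕ) < n - k)
  rw [Fin.card_filter_val_lt, Finset.card_univ, Fintype.card_fin] at h
  simp only [not_lt] at h
  rw [lastElts]
  omega

/-- `|m_s|!`, multiplied by `16` unless `s` consists of some of the last `k` elements. -/
noncomputable def blockWeight {n : ℕ} (k : ℕ) (m : Fin n → ℕ) (s : Finset (Fin n)) : ℝ :=
  (if s ⊆ lastElts n k then 1 else 16) * ((∑ x ∈ s, m x)! : ℝ)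

lemma blockWeight_nonneg {n : ℕ} (k : ℕ) (m : Fin n → ℕ) (s : Finset (Fin n)) :
    0 ≤ blockWeight k m s := by
  unfold blockWeight
  positivity

lemma sum_eq_card_of_subset_lastElts {n k : ℕ} {m : Fin n → ℕ}
    (hlast : ∀ i : Fin n, n - k ≤ (i : ℕ) → m i = 1) {s : Finset (Fin n)}
    (hs : s ⊆ lastElts n k) : ∑ x ∈ s, m x = s.card := by
  rw [card_eq_sum_ones]
  exact sum_congr rfl fun x hx => hlast x (mem_lastElts.1 (hs hx))

lemma sum_abs_le_blockWeight {n k : ℕ} {m : Fin n → ℕ}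
    (hlast : ∀ i : Fin n, n - k ≤ (i : ℕ) → m i = 1) (s : Finset (Fin n)) (N : ℕ) :
    ∑ d ∈ range N, |1 / (d ! : ℝ) * ((∑ x ∈ s, m x)! : ℝ) *
        zed ((∑ x ∈ s, m x : ℤ) - s.card - d + 1)| ≤ blockWeight k m s := by
  unfold blockWeight
  split_ifs with hs
  · have hsum := sum_eq_card_of_subset_lastElts hlast hs
    have hsum' : (∑ x ∈ s, m x : ℤ) = s.card := by exact_mod_cast hsum
    have hterm (d : ℕ) : |1 / (d ! : ℝ) * ((∑ x ∈ s, m x)! : ℝ) *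
        zed ((∑ x ∈ s, m x : ℤ) - s.card - d + 1)| =
          if d = 1 then ((∑ x ∈ s, m x)! : ℝ) else 0 := by
      have harg : (∑ x ∈ s, m x : ℤ) - s.card - d + 1 = 1 - d := by rw [hsum']; ring
      rw [harg]
      split_ifs with hd
      · subst hd
        simp [zed]
      · rw [zed_one_sub_natCast hd, mul_zero, abs_zero]
    simp only [hterm, sum_ite_eq', one_mul]
    split_ifs
    · exact le_rfl
    · positivity
  · have hexp : ∑ d ∈ range N, (1 / (d ! : ℝ)) ≤ 4 := by
      have h := Real.sum_le_exp_of_nonneg zero_le_one N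
      simp only [one_pow] at h
      linarith [Real.exp_one_lt_d9]
    have hM : (0 : ℝ) ≤ ((∑ x ∈ s, m x)! : ℝ) := by positivity
    calc _ ≤ ∑ d ∈ range N, 1 / (d ! : ℝ) * (((∑ x ∈ s, m x)! : ℝ) * 4) := by
          refine sum_le_sum fun d _ => ?_
          rw [mul_assoc, abs_mul, abs_mul, abs_of_nonneg hM,
            abs_of_nonneg (by positivity : (0 : ℝ) ≤ 1 / (d ! : ℝ))]
          gcongr
          exact abs_zed_le _
      _ ≤ 4 * (((∑ x ∈ s, m x)! : ℝ) * 4) := by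
          rw [← sum_mul]
          gcongr
      _ = _ := by ring

lemma abs_Emap_le_sum_surjective {n k : ℕ} {m : Fin n → ℕ}
    (hlast : ∀ i : Fin n, n - k ≤ (i : ℕ) → m i = 1) :
    |Emap Finset.univ m| ≤ ∑ r ∈ Finset.Icc 2 n, ∑ f : Fin n → Fin r with Function.Surjective f,
      ∏ i, blockWeight k m (fiberFinset f i) := by
  have hterm (P : Finset (Finset (Fin n))) :
      |(-1 : ℝ) ^ (P.card - 1) * ((P.card - 2)! : ℝ) *
        ∑ d ∈ Finset.finsuppAntidiag P (P.card - 2),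
          ∏ s ∈ P, (1 / ((d s)! : ℝ) * ((∑ x ∈ s, m x)! : ℝ) *
            zed ((∑ x ∈ s, m x : ℤ) - s.card - d s + 1))| ≤
        (P.card ! : ℝ) * ∏ s ∈ P, blockWeight k m s := by
    rw [abs_mul, abs_mul, abs_pow, abs_neg, abs_one, one_pow, one_mul, Nat.abs_cast]
    refine mul_le_mul (Nat.cast_le.2 (Nat.factorial_le (Nat.sub_le _ _))) ?_ (abs_nonneg _)
      (Nat.cast_nonneg _)
    refine (abs_sum_le_sum_abs _ _).trans ?_
    simp only [abs_prod]
    refine (sum_finsuppAntidiag_prod_le P _ (fun s d => |1 / (d ! : ℝ) *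
      ((∑ x ∈ s, m x)! : ℝ) * zed ((∑ x ∈ s, m x : ℤ) - s.card - d + 1)|)
      fun _ _ => abs_nonneg _).trans ?_
    exact prod_le_prod (fun s _ => sum_nonneg fun _ _ => abs_nonneg _)
      fun s _ => sum_abs_le_blockWeight hlast s _
  unfold Emap
  refine (abs_sum_le_sum_abs _ _).trans ((sum_le_sum fun P _ => hterm P).trans ?_)
  rw [← sum_fiberwise_of_maps_to (g := Finset.card) (t := Finset.Icc 2 n)]
  · refine sum_le_sum fun r hr => ?_
    refine le_trans (le_of_eq ?_) (sum_setPartition_le r _ (blockWeight_nonneg k m))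
    refine sum_congr ?_ fun P hP => ?_
    · ext P
      have := (Finset.mem_Icc.1 hr).1
      simp only [mem_filter, mem_univ, true_and]
      constructor
      · exact fun h => ⟨h.1.1, h.2⟩
      · exact fun h => ⟨⟨h.1, by omega⟩, h.2⟩
    · rw [(mem_filter.1 hP).2.2]
  · intro P hP
    have hP := (mem_filter.1 hP).2
    exact Finset.mem_Icc.2 ⟨hP.2, by simpa using hP.1.card_le⟩

lemma exists_equiv_notMem_of_subset_lastElts {n k : ℕ} {T : Finset (Fin n)}
    (hT : T ⊆ lastElts n k) :
    ∃ e : Fin (n - T.card) ≃ {x // x ∉ T}, ∀ y : Fin (n - T.card),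
      ((y : ℕ) < n - k → ((e y).1 : ℕ) = y) ∧ (n - k ≤ (y : ℕ) → n - k ≤ ((e y).1 : ℕ)) := by
  have hcard : Fintype.card (Fin (n - T.card)) = Tᶜ.card := by
    rw [card_compl, Fintype.card_fin, Fintype.card_fin]
  have hcast := Fin.castLE_injective (Nat.sub_le n T.card)
  obtain ⟨g, hg⟩ := Finset.exists_equiv_extend_of_card_eq hcard
    (s := univ.filter fun y : Fin (n - T.card) => (y : ℕ) < n - k)
    (f := Fin.castLE (Nat.sub_le n T.card))
    (fun x hx => by
      obtain ⟨y, hy, rfl⟩ := mem_image.1 hx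
      rw [mem_compl]
      intro hyT
      have h₁ := mem_lastElts.1 (hT hyT)
      have h₂ := (mem_filter.1 hy).2
      rw [Fin.val_castLE] at h₁
      omega)
    hcast.injOn
  have hg' (y : Fin (n - T.card)) (hy : (y : ℕ) < n - k) : ((g y).1 : ℕ) = y := by
    rw [hg y (mem_filter.2 ⟨mem_univ _, hy⟩), Fin.val_castLE]
  refine ⟨g.trans (Equiv.subtypeEquivRight fun x => mem_compl), fun y => ⟨hg' y, fun hy => ?_⟩⟩
  change n - k ≤ ((g y).1 : ℕ)
  by_contra! hlt
  have hTcard : T.card ≤ k ∨ n < k := by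
    by_cases hkn : k ≤ n
    · exact .inl (card_lastElts hkn ▸ card_le_card hT)
    · exact .inr (by omega)
  obtain ⟨z, hz⟩ : ∃ z : Fin (n - T.card), (z : ℕ) = ((g y).1 : ℕ) := ⟨⟨((g y).1 : ℕ), by omega⟩, rfl⟩
  have hzy : z = y := g.injective (Subtype.ext (Fin.ext ((hg' z (by omega)).trans hz)))
  subst hzy
  omega

lemma sum_prod_blockWeight_le {n k r : ℕ} (hkn : k ≤ n) {m : Fin n → ℕ}
    (hlast : ∀ i : Fin n, n - k ≤ (i : ℕ) → m i = 1) (A : Finset (Fin r))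
    {T : Finset (Fin n)} (hT : T ⊆ lastElts n k) :
    ∑ f : Fin n → Fin r with Function.Surjective f ∧
        (∀ i, i ∈ A ↔ fiberFinset f i ⊆ lastElts n k) ∧ ∀ x, x ∈ T ↔ f x ∈ A,
        ∏ i, blockWeight k m (fiberFinset f i) ≤
      16 ^ (r - A.card) * (((T.card)! : ℝ) * (if T.card < A.card then 0 else
        if A.card = 0 ∧ 0 < T.card then 0 else ((T.card - 1).choose (A.card - 1) : ℝ))) *
        ∑ α ∈ orderedV (n - T.card) (r - A.card) (k - T.card),
          ∏ j, ((∑ x ∈ α j, m (Fin.castLE (Nat.sub_le n T.card) x))! : ℝ) := by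
  set S : Finset (Fin n → Fin r) := univ.filter fun f => Function.Surjective f ∧
        (∀ i, i ∈ A ↔ fiberFinset f i ⊆ lastElts n k) ∧ ∀ x, x ∈ T ↔ f x ∈ A with hS
  have hTk : T.card ≤ k := card_lastElts hkn ▸ card_le_card hT
  obtain ⟨e, he⟩ := exists_equiv_notMem_of_subset_lastElts hT
  have hme (y : Fin (n - T.card)) :
      m (Fin.castLE (Nat.sub_le n T.card) y) = m (e y).1 := by
    rcases lt_or_ge (y : ℕ) (n - k) with hy | hy
    · congr 1
      exact Fin.ext ((he y).1 hy).symm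
    · rw [hlast _ ((he y).2 hy), hlast _ (by simpa using hy)]
  have a : Fin (r - A.card) ≃ {i // i ∉ A} :=
    Fintype.equivOfCardEq (by simp [Fintype.card_subtype_compl])
  set u : ({x // x ∈ T} → {i // i ∈ A}) → ℝ :=
    fun g => ∏ i, ((Fintype.card {x // g x = i})! : ℝ) with hu
  set v : (Fin (r - A.card) → Finset (Fin (n - T.card))) → ℝ :=
    fun α => ∏ j, ((∑ x ∈ α j, m (Fin.castLE (Nat.sub_le n T.card) x))! : ℝ) with hv
  set G : Finset ({x // x ∈ T} → {i // i ∈ A}) := univ.filter Function.Surjective with hG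
  have hu_sum : ∑ g ∈ G, u g ≤ ((T.card)! : ℝ) * (if T.card < A.card then 0 else
      if A.card = 0 ∧ 0 < T.card then 0 else ((T.card - 1).choose (A.card - 1) : ℝ)) := by
    have h := sum_surjective_prod_factorial_le {x // x ∈ T} {i // i ∈ A}
    rw [Fintype.card_coe, Fintype.card_coe] at h
    refine le_trans (le_of_eq ?_) (((Nat.cast_le (α := ℝ)).2 h).trans (le_of_eq ?_))
    · simp only [hu, hG, Nat.cast_sum, Nat.cast_prod]
      congr!
    · split_ifs <;> simp
  have hv_nonneg (α) : 0 ≤ v α := prod_nonneg fun _ _ => Nat.cast_nonneg _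
  have hu_nonneg (g) : 0 ≤ u g := prod_nonneg fun _ _ => Nat.cast_nonneg _
  have hfS (f : {f // f ∈ S}) := (mem_filter.1 f.2).2
  let split (f : {f // f ∈ S}) : ({x // x ∈ T} → {i // i ∈ A}) ×
      (Fin (r - A.card) → Finset (Fin (n - T.card))) :=
    (fun x => ⟨f.1 x.1, ((hfS f).2.2 x.1).1 x.2⟩,
      fun j => univ.filter fun y => f.1 (e y).1 = (a j).1)
  have hmaps (f : {f // f ∈ S}) : split f ∈ G ×ˢ orderedV (n - T.card) (r - A.card)
      (k - T.card) := by
    obtain ⟨hsurj, hA, hTA⟩ := hfS f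
    have hex (j : Fin (r - A.card)) : ∃ y, f.1 (e y).1 = (a j).1 ∧ ((e y).1 : ℕ) < n - k := by
      have h := (hA (a j).1).not.1 (a j).2
      obtain ⟨x, hx, hx'⟩ := Finset.not_subset.1 h
      rw [mem_fiberFinset] at hx
      rw [mem_lastElts, not_le] at hx'
      have hxT : x ∉ T := fun hxT => (a j).2 (hx ▸ (hTA x).1 hxT)
      refine ⟨e.symm ⟨x, hxT⟩, ?_⟩
      rw [e.apply_symm_apply]
      exact ⟨hx, hx'⟩
    rw [mem_product, hG, mem_filter, orderedV, mem_filter]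
    refine ⟨⟨mem_univ _, fun i => ?_⟩, mem_univ _, fun j => ?_, fun i j hij => ?_, fun y => ?_,
      fun j => ?_⟩
    · obtain ⟨x, hx⟩ := hsurj i.1
      exact ⟨⟨x, (hTA x).2 (hx ▸ i.2)⟩, Subtype.ext hx⟩
    · obtain ⟨y, hy, -⟩ := hex j
      exact Finset.ne_empty_of_mem (mem_filter.2 ⟨mem_univ y, hy⟩)
    · refine disjoint_filter.2 fun y _ hi hj => hij (a.injective (Subtype.ext (hi.symm.trans hj)))
    · have hy : f.1 (e y).1 ∉ A := (hTA _).not.1 (e y).2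
      refine ⟨a.symm ⟨_, hy⟩, mem_filter.2 ⟨mem_univ _, ?_⟩⟩
      rw [a.apply_symm_apply]
    · obtain ⟨y, hy, hy'⟩ := hex j
      refine ⟨y, mem_filter.2 ⟨mem_univ y, hy⟩, ?_⟩
      have := (he y).2
      omega
  have hinj : Function.Injective split := by
    intro f f' h
    refine Subtype.ext (funext fun x => ?_)
    by_cases hx : x ∈ T
    · exact congrArg Subtype.val (congrFun (congrArg Prod.fst h) ⟨x, hx⟩)
    · have hfx : f.1 x ∉ A := ((hfS f).2.2 x).not.1 hx
      have hmem : e.symm ⟨x, hx⟩ ∈ (split f).2 (a.symm ⟨f.1 x, hfx⟩) := by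
        simp [split]
      rw [h] at hmem
      simpa [split, eq_comm] using hmem
  have hweight (f : {f // f ∈ S}) : ∏ i, blockWeight k m (fiberFinset f.1 i) =
      16 ^ (r - A.card) * (u (split f).1 * v (split f).2) := by
    obtain ⟨hsurj, hA, hTA⟩ := hfS f
    have h₁ : ∏ i : {i // i ∈ A}, blockWeight k m (fiberFinset f.1 i) = u (split f).1 := by
      refine prod_congr rfl fun i _ => ?_
      have hi := (hA i.1).1 i.2
      rw [blockWeight, if_pos hi, one_mul, sum_eq_card_of_subset_lastElts hlast hi,
        ← Fintype.card_coe]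
      congr 2
      refine Fintype.card_congr
        { toFun := fun x => ⟨⟨x.1, (hTA _).2 ((mem_fiberFinset.1 x.2 : f.1 x.1 = i.1).symm ▸ i.2)⟩,
            Subtype.ext (mem_fiberFinset.1 x.2 : f.1 x.1 = i.1)⟩
          invFun := fun x => ⟨x.1.1, mem_fiberFinset.2 (congrArg Subtype.val x.2)⟩
          left_inv := fun _ => rfl
          right_inv := fun _ => rfl }
    have h₂ : ∏ i : {i // i ∉ A}, blockWeight k m (fiberFinset f.1 i) =
        16 ^ (r - A.card) * v (split f).2 := by
      rw [← a.prod_comp]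
      have hterm (j : Fin (r - A.card)) : blockWeight k m (fiberFinset f.1 (a j)) =
          16 * ((∑ x ∈ (split f).2 j, m (Fin.castLE (Nat.sub_le n T.card) x))! : ℝ) := by
        rw [blockWeight, if_neg ((hA _).not.1 (a j).2)]
        congr 3
        refine (sum_bij (fun y _ => (e y).1) ?_ ?_ ?_ ?_).symm
        · intro y hy
          exact mem_fiberFinset.2 (mem_filter.1 hy).2
        · intro y _ z _ h
          exact e.injective (Subtype.ext h)
        · intro x hx
          rw [mem_fiberFinset] at hx
          have hxT : x ∉ T := fun hxT => (a j).2 (hx ▸ (hTA x).1 hxT)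
          exact ⟨e.symm ⟨x, hxT⟩, mem_filter.2 ⟨mem_univ _, by rw [e.apply_symm_apply, hx]⟩,
            by rw [e.apply_symm_apply]⟩
        · exact fun y _ => hme y
      simp only [hterm, prod_mul_distrib, prod_const, Finset.card_univ, Fintype.card_fin, hv]
    have hcompl : ∏ i ∈ Aᶜ, blockWeight k m (fiberFinset f.1 i) =
        ∏ i : {i // i ∉ A}, blockWeight k m (fiberFinset f.1 i) :=
      prod_subtype _ (fun _ => mem_compl) _
    rw [← prod_mul_prod_compl A, ← prod_coe_sort A, h₁, hcompl, h₂]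
    ring
  calc ∑ f ∈ S, ∏ i, blockWeight k m (fiberFinset f i)
      = ∑ f : {f // f ∈ S}, ∏ i, blockWeight k m (fiberFinset f.1 i) :=
        (sum_coe_sort S _).symm
    _ ≤ ∑ p ∈ G ×ˢ orderedV (n - T.card) (r - A.card) (k - T.card),
          16 ^ (r - A.card) * (u p.1 * v p.2) :=
        sum_le_sum_of_mapsTo_injOn split (fun f _ => hmaps f) hinj.injOn
          (fun f _ => (hweight f).le)
          fun p _ => mul_nonneg (by positivity) (mul_nonneg (hu_nonneg _) (hv_nonneg _))
    _ = 16 ^ (r - A.card) * (∑ g ∈ G, u g) *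
          ∑ α ∈ orderedV (n - T.card) (r - A.card) (k - T.card), v α := by
        rw [← mul_sum, sum_product, mul_assoc, sum_mul_sum]
    _ ≤ _ := by
        refine mul_le_mul_of_nonneg_right ?_ (sum_nonneg fun α _ => hv_nonneg α)
        exact mul_le_mul_of_nonneg_left hu_sum (by positivity)

lemma sum_surjective_prod_blockWeight_le {n k r : ℕ} (hkn : k ≤ n) {m : Fin n → ℕ}
    (hlast : ∀ i : Fin n, n - k ≤ (i : ℕ) → m i = 1) :
    ∑ f : Fin n → Fin r with Function.Surjective f, ∏ i, blockWeight k m (fiberFinset f i) ≤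
      ∑ s ∈ range (r + 1), (2 : ℝ) ^ (4 * (r - s)) * (r.choose s : ℝ) *
        ∑ t ∈ Finset.Icc s k, ((k)! : ℝ) / ((k - t)! : ℝ) *
          (if s = 0 ∧ 0 < t then 0 else ((t - 1).choose (s - 1) : ℝ)) *
          ∑ α ∈ orderedV (n - t) (r - s) (k - t),
            ∏ j, ((∑ x ∈ α j, m (Fin.castLE (Nat.sub_le n t) x))! : ℝ) := by
  set V : ℕ → ℕ → ℝ := fun s t => ∑ α ∈ orderedV (n - t) (r - s) (k - t),
    ∏ j, ((∑ x ∈ α j, m (Fin.castLE (Nat.sub_le n t) x))! : ℝ) with hV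
  set B : ℕ → ℕ → ℝ := fun s t => 16 ^ (r - s) * (((t)! : ℝ) * (if t < s then 0 else
    if s = 0 ∧ 0 < t then 0 else ((t - 1).choose (s - 1) : ℝ))) * V s t with hB
  set short : (Fin n → Fin r) → Finset (Fin r) :=
    fun f => univ.filter fun i => fiberFinset f i ⊆ lastElts n k with hshort
  have hmem_short (f : Fin n → Fin r) (i : Fin r) :
      i ∈ short f ↔ fiberFinset f i ⊆ lastElts n k := by simp [short]
  set shortElts : (Fin n → Fin r) → Finset (Fin n) :=
    fun f => univ.filter fun x => f x ∈ short f with hshortElts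
  have hmem_shortElts (f : Fin n → Fin r) (x : Fin n) :
      x ∈ shortElts f ↔ f x ∈ short f := by simp [shortElts]
  have hmaps (f : Fin n → Fin r) : (short f, shortElts f) ∈
      (univ : Finset (Fin r)).powerset ×ˢ (lastElts n k).powerset := by
    rw [mem_product, Finset.mem_powerset, Finset.mem_powerset]
    refine ⟨subset_univ _, fun x hx => ?_⟩
    exact (hmem_short f _).1 ((hmem_shortElts f x).1 hx) (mem_fiberFinset.2 rfl)
  calc _ = ∑ p ∈ (univ : Finset (Fin r)).powerset ×ˢ (lastElts n k).powerset,
          ∑ f ∈ univ.filter (fun f : Fin n → Fin r => Function.Surjective f) with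
            (short f, shortElts f) = p, ∏ i, blockWeight k m (fiberFinset f i) :=
        (sum_fiberwise_of_maps_to (fun f _ => hmaps f) _).symm
    _ ≤ ∑ p ∈ (univ : Finset (Fin r)).powerset ×ˢ (lastElts n k).powerset,
          B p.1.card p.2.card := by
        refine sum_le_sum fun p hp => ?_
        have hpT := Finset.mem_powerset.1 (mem_product.1 hp).2
        refine le_trans ?_ (sum_prod_blockWeight_le hkn hlast p.1 hpT)
        refine sum_le_sum_of_subset_of_nonneg (fun f hf => ?_)
          fun f _ _ => prod_nonneg fun i _ => blockWeight_nonneg _ _ _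
        obtain ⟨hsurj, rfl⟩ := mem_filter.1 hf
        exact mem_filter.2 ⟨mem_univ _, (mem_filter.1 hsurj).2, hmem_short f, hmem_shortElts f⟩
    _ = ∑ s ∈ range (r + 1), (r.choose s : ℝ) *
          ∑ t ∈ range (k + 1), (k.choose t : ℝ) * B s t := by
        rw [sum_product]
        have hinner (s : ℕ) : ∑ T ∈ (lastElts n k).powerset, B s T.card =
            ∑ t ∈ range (k + 1), (k.choose t : ℝ) * B s t := by
          rw [sum_powerset_apply_card (B s), card_lastElts hkn]
          simp only [nsmul_eq_mul]
        simp only [hinner]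
        rw [sum_powerset_apply_card (fun s => ∑ t ∈ range (k + 1), (k.choose t : ℝ) * B s t),
          Finset.card_univ, Fintype.card_fin]
        simp only [nsmul_eq_mul]
    _ = _ := by
        refine sum_congr rfl fun s _ => ?_
        have hsub : Finset.Icc s k ⊆ range (k + 1) := fun t ht => by
          rw [Finset.mem_Icc] at ht
          rw [mem_range]
          omega
        rw [← sum_subset hsub fun t ht hts => ?_, mul_comm ((2 : ℝ) ^ _), mul_assoc]
        · congr 1
          rw [mul_sum]
          refine sum_congr rfl fun t ht => ?_
          obtain ⟨hst, htk⟩ := Finset.mem_Icc.1 ht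
          have hfac : (k.choose t : ℝ) * (t ! : ℝ) * ((k - t)! : ℝ) = (k ! : ℝ) := by
            exact_mod_cast Nat.choose_mul_factorial_mul_factorial htk
          have hpos : ((k - t)! : ℝ) ≠ 0 := by positivity
          rw [hB, ← hfac, mul_div_cancel_right₀ _ hpos, pow_mul]
          simp only [if_neg (not_lt.2 hst), hV]
          have h16 : (2 : ℝ) ^ 4 = 16 := by norm_num
          rw [h16]
          split_ifs <;> ring
        · rw [mem_range] at ht
          rw [Finset.mem_Icc] at hts
          have : t < s := by omega
          simp [hB, this]

/-- Let `k ≤ n` be positive integers and `m = (m₁, …, m_n)` an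
`n`-tuple of positive integers whose last `k` entries equal `1` and whose first `n − k`
entries are `≥ 2`.  Then
`|E(m)| ≤ Σ_{r=2}^n Σ_{s=0}^r 2^{4(r−s)} binom(r,s) Σ_{t=s}^k (k!/(k−t)!) binom(t−1,s−1)
  Σ_{α ∈ 𝔙_{n−t;r−s;k−t}} ∏_{j=1}^{r−s} |m_{α^(j)}|!`,
where `binom(t−1,s−1)` is interpreted as `1` when `s = t = 0` and as `0` when
`s = 0 < t`. -/
theorem abs_Emap_le_sum_orderedV (n k : ℕ) (hk : 0 < k) (hkn : k ≤ n)
    (m : Fin n → ℕ)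
    (hlast : ∀ i : Fin n, n - k ≤ (i : ℕ) → m i = 1)
    (hfirst : ∀ i : Fin n, (i : ℕ) < n - k → 2 ≤ m i) :
    |Emap Finset.univ m| ≤
      ∑ r ∈ Finset.Icc 2 n, ∑ s ∈ Finset.range (r + 1),
        (2 : ℝ) ^ (4 * (r - s)) * (r.choose s : ℝ) *
          ∑ t ∈ Finset.Icc s k,
            ((k)! : ℝ) / ((k - t)! : ℝ) *
              (if s = 0 ∧ 0 < t then 0 else ((t - 1).choose (s - 1) : ℝ)) *
              ∑ α ∈ orderedV (n - t) (r - s) (k - t),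
                ∏ j, ((∑ x ∈ α j, m (Fin.castLE (Nat.sub_le n t) x))! : ℝ) := by
  exact (abs_Emap_le_sum_surjective hlast).trans
    (sum_le_sum fun r _ => sum_surjective_prod_blockWeight_le hkn hlast)
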